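/- Consider the optimization problem: minimize over w ∈ ℝ^{n_w} and y₁,…,y_N ∈ ℝ the objective γ(w) + φ(Z₀) + Σ_{r=1}^{N} [φ(y_r) − φ(Z_{r−1})], subject to Z_{r−1} ≤ y_r ≤ Z_r for r = 1,…,N and Ā·(Z₀ + Σ_{r=1}^{N}[y_r − Z_{r−1}]) + B̄ w ≤ C̄ componentwise. If (w*, y₁*,…,y_N*) is an optimizer (a feasible point attaining the minimum), then for every r ∈ {1,…,N−1}: if y_r* = Z_{r−1}, then y_s* = Z_{s−1} for all s = r+1,…,N. -/

import Mathlib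

/-- If a convex function on `[a, u]` increases over the last stretch of length `δ` by no more than
over the first one, then it is affine on `[a, u]`. -/
lemma ConvexOn.exists_eq_affine_of_increment_le {φ : ℝ → ℝ} {a u δ : ℝ}
    (hφ : ConvexOn ℝ (Set.Icc a u) φ) (hδ : 0 < δ) (hau : a + δ ≤ u - δ)
    (hinc : φ u - φ (u - δ) ≤ φ (a + δ) - φ a) :
    ∃ p q : ℝ, ∀ x ∈ Set.Icc a u, φ x = p * x + q := by
  have key : ∀ {x y z : ℝ}, a ≤ x → x < y → y < z → z ≤ u →
      (z - x) * φ y ≤ (z - y) * φ x + (y - x) * φ z := by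
    intro x y z hx hxy hyz hz
    have hs := hφ.slope_mono_adjacent (x := x) (y := y) (z := z)
      ⟨hx, by linarith⟩ ⟨by linarith, hz⟩ hxy hyz
    rw [div_le_div_iff₀ (by linarith) (by linarith)] at hs
    linarith
  obtain ⟨m, hm⟩ : ∃ m, φ (a + δ) = φ a + m * δ :=
    ⟨(φ (a + δ) - φ a) / δ, by field_simp; ring⟩
  have lower : ∀ x, a + δ ≤ x → x ≤ u → φ a + m * (x - a) ≤ φ x := by
    intro x hx hxu
    rcases hx.eq_or_lt with rfl | hx
    · rw [hm]; linarith
    · have hk := key le_rfl (by linarith : a < a + δ) hx hxu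
      rw [hm] at hk
      refine le_of_mul_le_mul_left ?_ hδ
      linarith
  have hu : φ u = φ a + m * (u - a) := by
    refine le_antisymm ?_ (lower u (by linarith) le_rfl)
    have hk := key le_rfl (by linarith : a < u - δ) (by linarith : u - δ < u) le_rfl
    have h1 : φ u - m * δ ≤ φ (u - δ) := by linarith
    have h2 := mul_le_mul_of_nonneg_left h1 (by linarith : 0 ≤ u - a)
    refine le_of_mul_le_mul_left ?_ hδ
    linarith
  refine ⟨m, φ a - m * a, fun x hx => ?_⟩
  rcases hx.1.eq_or_lt with rfl | hax
  · ring
  rcases hx.2.eq_or_lt with rfl | hxu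
  · rw [hu]; ring
  refine le_antisymm ?_ ?_
  · have hk := key le_rfl hax hxu le_rfl
    rw [hu] at hk
    refine le_of_mul_le_mul_left ?_ (by linarith : 0 < u - a)
    linarith
  · rcases le_or_gt (a + δ) x with hx' | hx'
    · linarith [lower x hx' hxu.le]
    · have hk := key hax.le hx' (by linarith : a + δ < u) le_rfl
      rw [hu, hm] at hk
      refine le_of_mul_le_mul_left ?_ (by linarith : 0 < u - (a + δ))
      linarith

/-- The coefficients of a quadratic function that is affine on a nontrivial interval. -/
lemma quadratic_coeff_eq_of_eq_affine {a b h f g p q : ℝ} (hab : a < b)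
    (H : ∀ x ∈ Set.Icc a b, h / 2 * x ^ 2 + f * x + g = p * x + q) :
    h = 0 ∧ f = p ∧ g = q := by
  have h1 := H a ⟨le_rfl, hab.le⟩
  have h2 := H b ⟨hab.le, le_rfl⟩
  have h3 := H ((a + b) / 2) ⟨by linarith, by linarith⟩
  have hh : h = 0 := by
    have : h * (b - a) ^ 2 = 0 := by linear_combination 4 * h1 + 4 * h2 - 8 * h3
    simpa [sub_ne_zero.2 hab.ne'] using this
  subst hh
  have hf : f = p := by
    have : (f - p) * (b - a) = 0 := by linear_combination h2 - h1
    simpa [sub_ne_zero.2 hab.ne', sub_eq_zero] using this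
  subst hf
  exact ⟨rfl, rfl, by linarith⟩

/-- Theorem 2(ii): in the relaxed problem, if an optimizer has `y_r* = Z_{r-1}`
then all later variables stick to their lower bounds, `y_s* = Z_{s-1}`.
(Indices are 0-based: piece `r` lives on `[Z r, Z (r+1)]` for `r < N`.) -/
theorem stmt_2
    (nw mdim N : ℕ) (hN : 1 ≤ N)
    (γ : (Fin nw → ℝ) → ℝ) (hγ : ConvexOn ℝ Set.univ γ)
    (Z : ℕ → ℝ) (hZ : ∀ r, r < N → Z r < Z (r + 1))
    (φ : ℝ → ℝ)
    (hφconv : ConvexOn ℝ (Set.Icc (Z 0) (Z N)) φ)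
    (h f g : ℕ → ℝ)
    (hpw : ∀ r, r < N → ∀ z ∈ Set.Icc (Z r) (Z (r + 1)),
      φ z = h r / 2 * z ^ 2 + f r * z + g r)
    (hnondeg : ∀ r, r + 1 < N → 0 < h r ∨ (f r, g r) ≠ (f (r + 1), g (r + 1)))
    (A : Fin mdim → ℝ) (B : Matrix (Fin mdim) (Fin nw) ℝ) (C : Fin mdim → ℝ)
    (wstar : Fin nw → ℝ) (ystar : ℕ → ℝ)
    (hfeas : (∀ r, r < N → ystar r ∈ Set.Icc (Z r) (Z (r + 1))) ∧
      ∀ j, A j * (Z 0 + ∑ r ∈ Finset.range N, (ystar r - Z r)) + B.mulVec wstar j ≤ C j)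
    (hopt : ∀ (w : Fin nw → ℝ) (y : ℕ → ℝ),
      ((∀ r, r < N → y r ∈ Set.Icc (Z r) (Z (r + 1))) ∧
        ∀ j, A j * (Z 0 + ∑ r ∈ Finset.range N, (y r - Z r)) + B.mulVec w j ≤ C j) →
      γ wstar + φ (Z 0) + ∑ r ∈ Finset.range N, (φ (ystar r) - φ (Z r)) ≤
        γ w + φ (Z 0) + ∑ r ∈ Finset.range N, (φ (y r) - φ (Z r))) :
    ∀ r, r + 1 < N → ystar r = Z r → ∀ s, r < s → s < N → ystar s = Z s := by
  intro r hr hyr s hrs hsN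
  have hmono : ∀ i j, i ≤ j → j ≤ N → Z i ≤ Z j := by
    intro i j hij
    induction j, hij using Nat.le_induction with
    | base => exact fun _ => le_rfl
    | succ j _ ih => exact fun hj => (ih (by omega)).trans (hZ j (by omega)).le
  by_contra hne
  obtain ⟨hs1, hs2⟩ := hfeas.1 s hsN
  have hlt : Z s < ystar s := lt_of_le_of_ne hs1 (Ne.symm hne)
  have hZr := hZ r (by omega)
  have hZr1 := hZ (r + 1) hr
  have hrsZ := hmono (r + 1) s hrs hsN.le
  have hsub : Set.Icc (Z r) (ystar s) ⊆ Set.Icc (Z 0) (Z N) :=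
    Set.Icc_subset_Icc (hmono 0 r (by omega) (by omega))
      (hs2.trans (hmono (s + 1) N hsN le_rfl))
  obtain ⟨δ, hδ, hδr, hδs⟩ : ∃ δ, 0 < δ ∧ δ ≤ Z (r + 1) - Z r ∧ δ ≤ ystar s - Z s :=
    ⟨min (Z (r + 1) - Z r) (ystar s - Z s), lt_min (by linarith) (by linarith),
      min_le_left _ _, min_le_right _ _⟩
  have hinc : φ (ystar s) - φ (ystar s - δ) ≤ φ (Z r + δ) - φ (Z r) := by
    let y : ℕ → ℝ := fun i => if i = r then Z r + δ else if i = s then ystar s - δ else ystar i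
    have hsum : ∀ F : ℝ → ℝ, ∑ i ∈ Finset.range N, (F (y i) - F (Z i)) =
        ∑ i ∈ Finset.range N, (F (ystar i) - F (Z i)) + (F (Z r + δ) - F (Z r))
          + (F (ystar s - δ) - F (ystar s)) := by
      intro F
      have hpt : ∀ i ∈ Finset.range N, F (y i) - F (Z i) = (F (ystar i) - F (Z i))
          + (if i = r then F (Z r + δ) - F (Z r) else 0)
          + (if i = s then F (ystar s - δ) - F (ystar s) else 0) := by
        intro i _
        by_cases hir : i = r
        · subst hir
          simp [y, hrs.ne, hyr]
        · by_cases his : i = s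
          · subst his
            simp [y, hir]
          · simp [y, hir, his]
      rw [Finset.sum_congr rfl hpt, Finset.sum_add_distrib, Finset.sum_add_distrib,
        Finset.sum_ite_eq', Finset.sum_ite_eq', if_pos (Finset.mem_range.2 (by omega)),
        if_pos (Finset.mem_range.2 hsN)]
    have hle := hopt wstar y ⟨?_, ?_⟩
    · rw [hsum φ] at hle
      linarith
    · intro i hi
      by_cases hir : i = r
      · subst hir
        simp only [y, if_true]
        exact ⟨by linarith, by linarith⟩
      · by_cases his : i = s
        · subst his
          simp only [y, if_neg hir, if_true]
          exact ⟨by linarith, by linarith⟩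
        · simpa only [y, if_neg hir, if_neg his] using hfeas.1 i hi
    · intro j
      have hid := hsum id
      simp only [id] at hid
      have : ∑ i ∈ Finset.range N, (y i - Z i) = ∑ i ∈ Finset.range N, (ystar i - Z i) := by
        rw [hid]; ring
      rw [this]
      exact hfeas.2 j
  obtain ⟨p, q, haff⟩ := (hφconv.subset hsub (convex_Icc _ _)).exists_eq_affine_of_increment_le
    hδ (by linarith) hinc
  obtain ⟨h0, hf0, hg0⟩ := quadratic_coeff_eq_of_eq_affine hZr fun x hx =>
    (hpw r (by omega) x hx).symm.trans (haff x ⟨hx.1, by linarith [hx.2]⟩)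
  obtain ⟨-, hf1, hg1⟩ := quadratic_coeff_eq_of_eq_affine
    (lt_min hZr1 (by linarith : Z (r + 1) < ystar s)) fun x hx =>
    (hpw (r + 1) hr x ⟨hx.1, hx.2.trans (min_le_left _ _)⟩).symm.trans
      (haff x ⟨by linarith [hx.1], hx.2.trans (min_le_right _ _)⟩)
  rcases hnondeg r hr with hpos | hcoef
  · exact hpos.ne' h0
  · exact hcoef (by rw [hf0, hg0, hf1, hg1])
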